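/- arXiv:2510.21979 — 2 statements merged into one kernel-verified Lean document; each statement's English description precedes it below -/
import Mathlib

section
/- Let r be an odd prime power with r ≥ 5. Then the Sylow 2-subgroups of SL(2, r) are generalized quaternion groups. -/
open Matrix Polynomial

/-- Elements `A` of order `2m` and `X` with `X² = Aᵐ` and `A X A = X` generate a copy of
`QuaternionGroup m`. -/
theorem QuaternionGroup.exists_injective_hom {G : Type*} [Group G] {m : ℕ} (hm : 2 ≤ m) {A X : G}
    (hA : orderOf A = 2 * m) (hX : X * X = A ^ m) (hAX : A * X * A = X) :
    ∃ f : QuaternionGroup m →* G, Function.Injective f := by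
  let φ : ZMod (2 * m) →+ Additive G := ZMod.lift (2 * m) ⟨zmultiplesHom _ (Additive.ofMul A), by
    simp only [zmultiplesHom_apply, natCast_zsmul, ← ofMul_pow, ← hA, pow_orderOf_eq_one,
      ofMul_one]⟩
  let g : ZMod (2 * m) → G := fun i => (φ i).toMul
  have g_int : ∀ k : ℤ, g k = A ^ k := fun k => by
    simp only [g, φ, ZMod.lift_coe, zmultiplesHom_apply, ← ofMul_zpow, toMul_ofMul]
  have g_nat : g (m : ZMod (2 * m)) = A ^ m := by simpa using g_int m
  have g_zero : g 0 = 1 := by simp [g]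
  have g_add : ∀ i j, g (i + j) = g i * g j := fun i j => by simp [g]
  have g_inj : Function.Injective g := by
    intro i j hij
    obtain ⟨i, rfl⟩ := ZMod.intCast_surjective i
    obtain ⟨j, rfl⟩ := ZMod.intCast_surjective j
    rw [g_int, g_int, zpow_eq_zpow_iff_modEq, hA] at hij
    exact (ZMod.intCast_eq_intCast_iff _ _ _).2 hij
  have hconj : X⁻¹ * A * X = A⁻¹ := by
    rw [eq_inv_iff_mul_eq_one]
    calc X⁻¹ * A * X * A = X⁻¹ * (A * X * A) := by group
      _ = 1 := by rw [hAX, inv_mul_cancel]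
  have g_X : ∀ i, g i * X = X * g (-i) := by
    intro i
    obtain ⟨i, rfl⟩ := ZMod.intCast_surjective i
    have h : (X⁻¹ * A * X) ^ i = X⁻¹ * A ^ i * X := by
      simpa using conj_zpow (i := i) (a := X⁻¹) (b := A)
    rw [← Int.cast_neg, g_int, g_int, _root_.zpow_neg, ← _root_.inv_zpow, ← hconj, h]
    group
  have hXg : ∀ i, X ≠ g i := by
    intro i hi
    obtain ⟨i, rfl⟩ := ZMod.intCast_surjective i
    rw [g_int] at hi
    have hcomm : A * X = X * A := by rw [hi]; group
    have h2 : A ^ 2 = 1 := by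
      have : X * A ^ 2 = X := by rw [pow_two, ← mul_assoc, ← hcomm, hAX]
      simpa using this
    have := Nat.le_of_dvd two_pos (hA ▸ orderOf_dvd_of_pow_eq_one h2)
    omega
  let f : QuaternionGroup m → G
    | .a i => g i
    | .xa i => X * g i
  refine ⟨⟨⟨f, g_zero⟩, ?_⟩, ?_⟩
  · rintro (i | i) (j | j)
    · exact g_add i j
    · change X * g (j - i) = g i * (X * g j)
      rw [← mul_assoc, g_X, mul_assoc, ← g_add, neg_add_eq_sub]
    · change X * g (i + j) = X * g i * g j
      rw [g_add, mul_assoc]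
    · change g (m + j - i) = X * g i * (X * g j)
      rw [mul_assoc, ← mul_assoc (g i), g_X, mul_assoc, ← mul_assoc, hX, ← g_add, ← g_nat, ← g_add]
      congr 1
      ring
  · rintro (i | i) (j | j) h
    · exact congrArg _ (g_inj h)
    · change g i = X * g j at h
      refine (hXg (i - j) ?_).elim
      rw [← mul_left_inj (g j), ← g_add, ← h, sub_add_cancel]
    · change X * g i = g j at h
      refine (hXg (j - i) ?_).elim
      rw [← mul_left_inj (g i), ← g_add, h, sub_add_cancel]
    · exact congrArg _ (g_inj (mul_left_cancel h))

/-- The order of `SL(2, q)` is `q(q - 1)(q + 1)`. -/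
theorem Matrix.SpecialLinearGroup.card_fin_two (F : Type*) [Field F] [Fintype F] :
    Nat.card (SpecialLinearGroup (Fin 2) F) =
      Fintype.card F * (Fintype.card F - 1) * (Fintype.card F + 1) := by
  classical
  have hrange : (SpecialLinearGroup.toGL (n := Fin 2) (R := F)).range =
      (GeneralLinearGroup.det (n := Fin 2) (R := F)).ker := by
    ext M
    rw [MonoidHom.mem_ker]
    constructor
    · rintro ⟨N, rfl⟩
      ext
      simp
    · intro h
      refine ⟨⟨M.1, by simpa using congrArg Units.val h⟩, ?_⟩
      ext
      rfl
  have hsurj : Function.Surjective (GeneralLinearGroup.det (n := Fin 2) (R := F)) := by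
    intro u
    refine ⟨GeneralLinearGroup.mkOfDetNeZero !![(u : F), 0; 0, 1] (by simp), ?_⟩
    ext
    simp [GeneralLinearGroup.mkOfDetNeZero]
  have hSL : Nat.card (SpecialLinearGroup (Fin 2) F) =
      Nat.card (GeneralLinearGroup.det (n := Fin 2) (R := F)).ker := by
    rw [← hrange]
    exact Nat.card_congr (MonoidHom.ofInjective SpecialLinearGroup.toGL_injective).toEquiv
  have h := Subgroup.card_mul_index (GeneralLinearGroup.det (n := Fin 2) (R := F)).ker
  rw [Subgroup.index_ker, MonoidHom.range_eq_top.2 hsurj, Subgroup.card_top,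
    Nat.card_eq_fintype_card (α := Fˣ), Fintype.card_units, ← hSL, card_GL_field] at h
  have hq : 1 < Fintype.card F := Fintype.one_lt_card
  obtain ⟨k, hk⟩ := Nat.exists_eq_add_of_lt hq
  simp only [Fin.prod_univ_two, Fin.val_zero, Fin.val_one, pow_zero, pow_one] at h
  rw [hk] at h ⊢
  have h1 : (1 + k + 1) ^ 2 - 1 = (k + 1) * (k + 3) :=
    Nat.sub_eq_of_eq_add (by ring)
  have h2 : (1 + k + 1) ^ 2 - (1 + k + 1) = (k + 1) * (k + 2) :=
    Nat.sub_eq_of_eq_add (by ring)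
  have h3 : 1 + k + 1 - 1 = k + 1 := by omega
  rw [h1, h2, h3] at h
  rw [h3]
  apply Nat.eq_of_mul_eq_mul_right (Nat.succ_pos k)
  rw [Nat.succ_eq_add_one, h]
  ring

/-- The 2-part of `q(q - 1)(q + 1)` for odd `q`. -/
theorem Nat.factorization_two_of_odd {q : ℕ} (hodd : Odd q) (hq : 1 < q) :
    ∃ n, 1 ≤ n ∧ (2 * 2 ^ n ∣ q - 1 ∨ 2 * 2 ^ n ∣ q + 1) ∧
      (q * (q - 1) * (q + 1)).factorization 2 = n + 2 := by
  have key : ∀ {n s N : ℕ}, Odd s → N = 2 ^ (n + 2) * s → N.factorization 2 = n + 2 := by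
    rintro n s N hs rfl
    rw [Nat.factorization_mul (by positivity) hs.pos.ne', Nat.Prime.factorization_pow prime_two]
    simp [Nat.factorization_eq_zero_of_not_dvd hs.not_two_dvd_nat]
  have split : ∀ {k : ℕ}, 0 < k → ∃ n s, 1 ≤ n ∧ Odd s ∧ 4 * k = 2 * 2 ^ n * s := by
    intro k hk
    obtain ⟨n, s, hs, rfl⟩ := Nat.exists_eq_two_pow_mul_odd hk.ne'
    exact ⟨n + 1, s, by omega, hs, by ring⟩
  have hmod : q % 4 = 1 ∨ q % 4 = 3 := by
    have := Nat.odd_iff.1 hodd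
    omega
  rcases hmod with h | h
  · obtain ⟨n, s, hn, hs, hk⟩ := split (k := q / 4) (by omega)
    have h1 : q - 1 = 2 * 2 ^ n * s := by omega
    have h2 : q + 1 = 2 * (2 * (q / 4) + 1) := by omega
    refine ⟨n, hn, .inl ⟨s, h1⟩,
      key ((hodd.mul hs).mul (odd_two_mul_add_one (q / 4))) ?_⟩
    rw [h1, h2]
    ring
  · obtain ⟨n, s, hn, hs, hk⟩ := split (k := q / 4 + 1) (by omega)
    have h1 : q + 1 = 2 * 2 ^ n * s := by omega
    have h2 : q - 1 = 2 * (2 * (q / 4) + 1) := by omega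
    refine ⟨n, hn, .inr ⟨s, h1⟩,
      key ((hodd.mul hs).mul (odd_two_mul_add_one (q / 4))) ?_⟩
    rw [h1, h2]
    ring

/-- The elements of an extension of a finite field fixed by Frobenius lie in the base field. -/
theorem FiniteField.exists_algebraMap_eq_of_pow_card_eq {F K : Type*} [Field F] [Fintype F]
    [Field K] [Algebra F K] {x : K} (hx : x ^ Fintype.card F = x) :
    ∃ t : F, algebraMap F K t = x := by
  have hsplits : (X ^ Fintype.card F - X : F[X]).Splits := by
    rw [splits_iff_card_roots, FiniteField.roots_X_pow_card_sub_X,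
      FiniteField.X_pow_card_sub_X_natDegree_eq F Fintype.one_lt_card]
    rfl
  have hroots := hsplits.roots_map (algebraMap F K)
  rw [FiniteField.roots_X_pow_card_sub_X] at hroots
  have hmem : x ∈ ((X ^ Fintype.card F - X : F[X]).map (algebraMap F K)).roots := by
    rw [mem_roots (Polynomial.map_ne_zero
      (FiniteField.X_pow_card_sub_X_ne_zero F Fintype.one_lt_card))]
    simp [hx]
  rw [hroots] at hmem
  obtain ⟨t, -, ht⟩ := Multiset.mem_map.1 hmem
  exact ⟨t, ht⟩

/-- If the roots `ζ`, `ζ⁻¹` of `X² - tX + 1` satisfy `ζᵐ = -1` and are distinct, then its companion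
matrix has `m`-th power `-1`. -/
theorem Matrix.companion_pow_eq_neg_one {F K : Type*} [Field F] [Field K] [Algebra F K] {m : ℕ}
    {t : F} {ζ : K} (hm : ζ ^ m = -1) (hne : ζ ≠ ζ⁻¹) (ht : algebraMap F K t = ζ + ζ⁻¹) :
    (!![0, -1; 1, t] : Matrix (Fin 2) (Fin 2) F) ^ m = -1 := by
  have hζ : ζ ≠ 0 := by
    rintro rfl
    simp at hne
  let B : Matrix (Fin 2) (Fin 2) K := !![0, -1; 1, ζ + ζ⁻¹]
  have eigen : ∀ {x y : K}, x * y = 1 → x + y = ζ + ζ⁻¹ → ∀ k : ℕ,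
      B ^ k * (B - x • 1) = y ^ k • (B - x • 1) := by
    intro x y hxy hs k
    have hB : B * (B - x • 1) = y • (B - x • 1) := by
      simp only [B, ← hs]
      ext i j
      fin_cases i <;> fin_cases j <;> simp [Matrix.mul_apply, Fin.sum_univ_two] <;> grind
    induction k with
    | zero => simp
    | succ k ih => rw [pow_succ, mul_assoc, hB, mul_smul_comm, ih, smul_smul, pow_succ']
  have h1 := eigen (mul_inv_cancel₀ hζ) rfl m
  have h2 := eigen (inv_mul_cancel₀ hζ) (add_comm _ _) m
  rw [inv_pow, hm, inv_neg_one] at h1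
  rw [hm] at h2
  have hB : B ^ m = -1 := by
    have h3 : (ζ - ζ⁻¹) • B ^ m = (ζ - ζ⁻¹) • (-1 : Matrix (Fin 2) (Fin 2) K) := by
      rw [mul_sub, mul_smul_comm, mul_one] at h1 h2
      linear_combination (norm := module) h2 - h1
    exact smul_right_injective _ (sub_ne_zero.2 hne) h3
  apply Matrix.map_injective (algebraMap F K).injective
  have hmap : (!![0, -1; 1, t] : Matrix (Fin 2) (Fin 2) F).map (algebraMap F K) = B := by
    ext i j
    fin_cases i <;> fin_cases j <;> simp [B, ht]
  change (algebraMap F K).mapMatrix _ = (algebraMap F K).mapMatrix _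
  rw [map_pow, map_neg, map_one, RingHom.mapMatrix_apply, hmap, hB]

/-- Two is nonzero in a finite field of odd order. -/
theorem FiniteField.two_ne_zero_of_odd_card {F : Type*} [Field F] [Fintype F]
    (hodd : Odd (Fintype.card F)) : (2 : F) ≠ 0 := by
  refine Ring.two_ne_zero fun h => ?_
  have := FiniteField.even_card_of_char_two h
  have := Nat.odd_iff.1 hodd
  omega

/-- Nondegenerate forms `a² + tac + c²` over a finite field of odd order represent `-1`. -/
theorem FiniteField.exists_sq_add_mul_add_sq_eq_neg_one {F : Type*} [Field F] [Fintype F]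
    (hodd : Odd (Fintype.card F)) {t : F} (ht : t ^ 2 ≠ 4) :
    ∃ a c : F, a ^ 2 + t * a * c + c ^ 2 = -1 := by
  have h2 : (2 : F) ≠ 0 := FiniteField.two_ne_zero_of_odd_card hodd
  have h4 : (4 : F) ≠ 0 := by
    convert pow_ne_zero 2 h2 using 1
    norm_num
  have hd : 1 - t ^ 2 / 4 ≠ 0 := by
    intro h
    apply ht
    field_simp at h
    linear_combination -h
  obtain ⟨a, c, h⟩ := FiniteField.exists_root_sum_quadratic
    (f := C (1 : F) * X ^ 2 + C 0 * X + C 1) (g := C (1 - t ^ 2 / 4) * X ^ 2 + C 0 * X + C 0)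
    (degree_quadratic one_ne_zero) (degree_quadratic hd) (Nat.odd_iff.1 hodd)
  refine ⟨a - t * c / 2, c, ?_⟩
  simp only [eval_add, eval_mul, eval_C, eval_pow, eval_X] at h
  field_simp at h ⊢
  linear_combination h

/-- A finite field of odd order contains the trace of a matrix of determinant one whose `m`-th power
is `-1`, provided that `2m` divides `q - 1` or `q + 1`. -/
theorem FiniteField.exists_companion_pow_eq_neg_one {F : Type*} [Field F] [Fintype F]
    (hodd : Odd (Fintype.card F)) {m : ℕ} (hm : Even m) (hm0 : 0 < m)
    (hdvd : 2 * m ∣ Fintype.card F - 1 ∨ 2 * m ∣ Fintype.card F + 1) :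
    ∃ t : F, t ^ 2 ≠ 4 ∧ (!![0, -1; 1, t] : Matrix (Fin 2) (Fin 2) F) ^ m = -1 := by
  have h2 : (2 : F) ≠ 0 := FiniteField.two_ne_zero_of_odd_card hodd
  let K := AlgebraicClosure F
  have h2K : (2 : K) ≠ 0 := by
    rw [← map_ofNat (algebraMap F K)]
    exact (_root_.map_ne_zero (algebraMap F K)).2 h2
  obtain ⟨ζ, hζ⟩ := IsAlgClosed.exists_pow_nat_eq (-1 : K) hm0
  have hζ0 : ζ ≠ 0 := by
    rintro rfl
    simp [hm0.ne'] at hζ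
  have hζ2 : ζ ^ (2 * m) = 1 := by rw [mul_comm, pow_mul, hζ]; norm_num
  have hne : ζ ≠ ζ⁻¹ := by
    intro h
    obtain ⟨k, hk⟩ := hm
    have : ζ ^ m = 1 := by
      rw [hk, ← two_mul, pow_mul, pow_two]
      nth_rw 2 [h]
      rw [mul_inv_cancel₀ hζ0, one_pow]
    apply h2K
    linear_combination hζ - this
  have hfix : (ζ + ζ⁻¹) ^ Fintype.card F = ζ + ζ⁻¹ := by
    have hadd := map_add (FiniteField.frobeniusAlgHom F K) ζ ζ⁻¹
    simp only [FiniteField.frobeniusAlgHom_apply] at hadd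
    rw [hadd, inv_pow]
    rcases hdvd with ⟨k, hk⟩ | ⟨k, hk⟩
    · have : ζ ^ Fintype.card F = ζ := by
        rw [← Nat.sub_add_cancel (Fintype.card_pos (α := F)), pow_succ, hk, pow_mul, hζ2, one_pow,
          one_mul]
      rw [this]
    · have : ζ ^ Fintype.card F = ζ⁻¹ := by
        rw [← mul_eq_one_iff_eq_inv₀ hζ0, ← pow_succ, hk, pow_mul, hζ2, one_pow]
      rw [this, inv_inv, add_comm]
  obtain ⟨t, ht⟩ := FiniteField.exists_algebraMap_eq_of_pow_card_eq hfix
  refine ⟨t, fun h => hne ?_, Matrix.companion_pow_eq_neg_one hζ hne ht⟩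
  have h4 := congrArg (algebraMap F K) h
  rw [map_pow, ht, map_ofNat] at h4
  rw [← sub_eq_zero]
  apply pow_eq_zero_iff two_ne_zero |>.1
  linear_combination h4 - 4 * mul_inv_cancel₀ hζ0

theorem sylow_two_SL2_odd_is_generalized_quaternion (F : Type*) [Field F] [Fintype F]
    (hodd : Odd (Fintype.card F)) (h5 : 5 ≤ Fintype.card F)
    (P : Sylow 2 (Matrix.SpecialLinearGroup (Fin 2) F)) :
    ∃ n : ℕ, 1 ≤ n ∧ Nonempty (P ≃* QuaternionGroup (2 ^ n)) := by
  obtain ⟨n, hn, hdvd, hfac⟩ := Nat.factorization_two_of_odd hodd (by omega)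
  refine ⟨n, hn, ?_⟩
  obtain ⟨t, ht, hpow⟩ := FiniteField.exists_companion_pow_eq_neg_one hodd
    (even_two.pow_of_ne_zero (by omega)) (by positivity) hdvd
  obtain ⟨a, c, hac⟩ := FiniteField.exists_sq_add_mul_add_sq_eq_neg_one hodd ht
  have h2 : (2 : F) ≠ 0 := FiniteField.two_ne_zero_of_odd_card hodd
  obtain ⟨A, hAval⟩ : ∃ A : SpecialLinearGroup (Fin 2) F,
      (A : Matrix (Fin 2) (Fin 2) F) = !![0, -1; 1, t] :=
    ⟨⟨_, by simp [det_fin_two]⟩, rfl⟩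
  obtain ⟨Y, hYval⟩ : ∃ Y : SpecialLinearGroup (Fin 2) F,
      (Y : Matrix (Fin 2) (Fin 2) F) = !![a, c + a * t; c, -a] :=
    ⟨⟨_, by rw [det_fin_two_of]; linear_combination -hac⟩, rfl⟩
  have hA : A ^ 2 ^ n = -1 := by
    refine Matrix.SpecialLinearGroup.ext _ _ fun i j => ?_
    rw [Matrix.SpecialLinearGroup.coe_pow, hAval, hpow, Matrix.SpecialLinearGroup.coe_neg,
      Matrix.SpecialLinearGroup.coe_one]
  have hA1 : A ^ 2 ^ n ≠ 1 := by
    rw [hA]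
    intro h
    have := congrArg (fun M : SpecialLinearGroup (Fin 2) F => M.1 0 0) h
    simp at this
    apply h2
    linear_combination -this
  have hord : orderOf A = 2 * 2 ^ n := by
    rw [← pow_succ']
    refine orderOf_eq_prime_pow hA1 ?_
    rw [pow_succ, pow_mul, hA, neg_one_sq]
  have hY : Y * Y = A ^ 2 ^ n := by
    rw [hA]
    refine Matrix.SpecialLinearGroup.ext _ _ fun i j => ?_
    rw [Matrix.SpecialLinearGroup.coe_mul, Matrix.SpecialLinearGroup.coe_neg,
      Matrix.SpecialLinearGroup.coe_one, hYval]
    fin_cases i <;> fin_cases j <;> simp [Matrix.mul_apply, Fin.sum_univ_two] <;> grind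
  have hAY : A * Y * A = Y := by
    refine Matrix.SpecialLinearGroup.ext _ _ fun i j => ?_
    rw [Matrix.SpecialLinearGroup.coe_mul, Matrix.SpecialLinearGroup.coe_mul, hAval, hYval]
    fin_cases i <;> fin_cases j <;> simp [Matrix.mul_apply, Fin.sum_univ_two] <;> ring
  obtain ⟨f, hf⟩ := QuaternionGroup.exists_injective_hom
    (Nat.le_self_pow (by omega) 2) hord hY hAY
  let e := MonoidHom.ofInjective hf
  have hcard : Nat.card f.range =
      2 ^ (Nat.card (SpecialLinearGroup (Fin 2) F)).factorization 2 := by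
    rw [← Nat.card_congr e.toEquiv, Nat.card_eq_fintype_card, QuaternionGroup.card,
      Matrix.SpecialLinearGroup.card_fin_two, hfac]
    ring
  exact ⟨(P.equiv (Sylow.ofCard f.range hcard)).trans e.symm⟩
end

section
/- Let P be a finite 2-group all of whose subgroups that act Frobeniusly (fixed-point-freely) could be complements; specifically: if a finite 2-group Q of order at least 4 acts on a nontrivial finite group K so that Q ∩ K = 1 and QK is a Frobenius group with complement Q, and Q is not cyclic, then Q is generalized quaternion. -/
/-- In a group acting fixed-point-freely on a nontrivial finite group, there is at most one
involution: every involution acts by inversion. -/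
theorem eq_of_sq_eq_one_of_fixedPointFree {Q K : Type*} [Group Q] [Group K] [Finite K]
    [Nontrivial K] [MulDistribMulAction Q K]
    (hfree : ∀ q : Q, q ≠ 1 → ∀ k : K, q • k = k → k = 1) {x y : Q}
    (hx : x ^ 2 = 1) (hx1 : x ≠ 1) (hy : y ^ 2 = 1) (hy1 : y ≠ 1) : x = y := by
  have inverts : ∀ q : Q, q ^ 2 = 1 → q ≠ 1 → ∀ k : K, q • k = k⁻¹ := by
    intro q hq hq1 k
    have hfpf : MonoidHom.FixedPointFree (MulDistribMulAction.toMonoidHom K q) :=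
      fun k hk => hfree q hq1 k hk
    have hinv : Function.Involutive (MulDistribMulAction.toMonoidHom K q) := fun k => by
      simp [← mul_smul, ← sq, hq]
    exact congrFun (hfpf.coe_eq_inv_of_involutive hinv) k
  obtain ⟨k, hk⟩ := exists_ne (1 : K)
  by_contra hne
  refine hk (hfree (x⁻¹ * y) (fun h => hne (inv_mul_eq_one.mp h)) k ?_)
  rw [mul_smul, inv_smul_eq_iff, inverts x hx hx1, inverts y hy hy1]

/-- Let `r, s` be integers such that no `i * (1 + r) + s` is divisible by `2 ^ (n + 1)`. Under the
congruences satisfied by the structure constants of an extension of a cyclic group of order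
`2 ^ (n + 1)` by a group of order two, either `s` is odd or the extension is quaternion. -/
theorem odd_or_congruences_of_forall_not_dvd {n : ℕ} {r s : ℤ}
    (hr : (2 : ℤ) ^ (n + 1) ∣ r * r - 1) (hs : (2 : ℤ) ^ (n + 1) ∣ s * (r - 1))
    (h : ∀ i : ℤ, ¬ (2 : ℤ) ^ (n + 1) ∣ i * (1 + r) + s) :
    Odd s ∨ 1 ≤ n ∧ (2 : ℤ) ^ (n + 1) ∣ r + 1 ∧ (2 : ℤ) ^ (n + 1) ∣ s - 2 ^ n := by
  refine (Int.even_or_odd s).symm.imp_right fun hs2 => ?_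
  have cop : ∀ {u : ℤ} (k : ℕ), Odd u → IsCoprime ((2 : ℤ) ^ k) u := fun k hu =>
    (Int.isCoprime_two_left.mpr hu).pow_left
  obtain ⟨t, rfl⟩ := hs2
  have hrodd : Odd r := by
    have h2 : (2 : ℤ) ∣ r * r - 1 := (dvd_pow_self 2 n.succ_ne_zero).trans hr
    rcases Int.even_or_odd r with ⟨v, rfl⟩ | hr
    · ring_nf at h2
      omega
    · exact hr
  obtain ⟨v, rfl⟩ := hrodd
  rcases Int.even_or_odd v with hv | hv
  · obtain ⟨c, d, hcd⟩ := cop (n + 1) hv.add_one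
    exact absurd ⟨2 * t * c, by linear_combination (-2 * t) * hcd⟩ (h (-t * d))
  · have hpow : (2 : ℤ) ^ (n + 1) = 2 * 2 ^ n := by ring
    have cancel : ∀ w : ℤ, (2 : ℤ) ^ (n + 1) ∣ w * (2 * v) → (2 : ℤ) ^ n ∣ w := by
      rintro w ⟨q, hq⟩
      refine (cop n hv).dvd_of_dvd_mul_right ⟨q, ?_⟩
      rw [hpow] at hq
      linarith
    obtain ⟨p, hp⟩ := cancel (2 * v + 1 + 1) (by convert hr using 1; ring)
    obtain ⟨q, hq⟩ := cancel (t + t) (by convert hs using 1; ring)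
    have hqodd : Odd q := by
      rw [← Int.not_even_iff_odd]
      rintro ⟨q', rfl⟩
      exact h 0 ⟨q', by linear_combination hq⟩
    have hpeven : Even p := by
      rw [← Int.not_odd_iff_even]
      intro hp'
      obtain ⟨w, hw⟩ := hp'.add_odd hqodd
      exact h 1 ⟨w, by linear_combination hp + hq + 2 ^ n * hw⟩
    obtain ⟨p', rfl⟩ := hpeven
    obtain ⟨q', rfl⟩ := hqodd
    refine ⟨?_, ⟨p', by linear_combination hp⟩, ⟨q', by linear_combination hq⟩⟩
    rcases n with _ | n
    · simp at hq
      omega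
    · omega

section UniqueInvolution

variable {G : Type*} [Group G]

open Subgroup

/-- In a group with at most one involution, let `b` normalise `⟨a⟩` and satisfy `b ∉ ⟨a⟩`,
`b ^ 2 ∈ ⟨a⟩`. Then either `b ^ 2` generates `⟨a⟩` or `a` and `b` satisfy the quaternion
relations. -/
theorem mem_zpowers_sq_or_quaternion_relations
    (huniq : ∀ x y : G, x ^ 2 = 1 → x ≠ 1 → y ^ 2 = 1 → y ≠ 1 → x = y) {a b : G} {n : ℕ}
    (ha : orderOf a = 2 ^ (n + 1)) (hb : b ∉ zpowers a) (hb2 : b ^ 2 ∈ zpowers a)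
    (hconj : b * a * b⁻¹ ∈ zpowers a) :
    a ∈ zpowers (b ^ 2) ∨ 1 ≤ n ∧ b * a * b⁻¹ = a⁻¹ ∧ b ^ 2 = a ^ 2 ^ n := by
  obtain ⟨s, hs⟩ := hb2
  obtain ⟨r, hr⟩ := hconj
  simp only at hs hr
  have hdvd : ∀ i : ℤ, (2 : ℤ) ^ (n + 1) ∣ i ↔ a ^ i = 1 := fun i => by
    rw [← orderOf_dvd_iff_zpow_eq_one, ha]
    norm_cast
  have conj_zpow : ∀ i : ℤ, b * a ^ i * b⁻¹ = a ^ (r * i) := fun i => by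
    rw [← conj_zpow, ← hr, zpow_mul]
  have hr2 : (2 : ℤ) ^ (n + 1) ∣ r * r - 1 := by
    have hcomm : b ^ 2 * a * (b ^ 2)⁻¹ = a := by
      rw [← hs, (Commute.refl a).zpow_left s |>.eq, mul_inv_cancel_right]
    rw [hdvd, zpow_sub, zpow_one, mul_inv_eq_one, ← conj_zpow, hr]
    rw [sq] at hcomm
    simpa [mul_assoc] using hcomm
  have hs2 : (2 : ℤ) ^ (n + 1) ∣ s * (r - 1) := by
    rw [hdvd, mul_sub, mul_one, zpow_sub, mul_inv_eq_one, mul_comm s, ← conj_zpow, hs]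
    group
  have hsq : ∀ i : ℤ, (a ^ i * b) ^ 2 = a ^ (i * (1 + r) + s) := fun i => by
    have : (a ^ i * b) ^ 2 = a ^ i * (b * a ^ i * b⁻¹) * b ^ 2 := by
      simp [sq, mul_assoc]
    rw [this, conj_zpow, ← hs, ← zpow_add, ← zpow_add]
    ring_nf
  have hnot : ∀ i : ℤ, ¬ (2 : ℤ) ^ (n + 1) ∣ i * (1 + r) + s := by
    intro i hi
    rw [hdvd, ← hsq] at hi
    have hmem : a ^ i * b ∉ zpowers a := fun hmem =>
      hb ((mul_mem_cancel_left (zpow_mem (mem_zpowers a) i)).mp hmem)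
    have hz2 : (a ^ 2 ^ n) ^ 2 = 1 := by
      rw [← pow_mul, ← pow_succ, ← ha, pow_orderOf_eq_one]
    have hz1 : a ^ 2 ^ n ≠ 1 := pow_ne_one_of_lt_orderOf (by positivity)
      (ha ▸ Nat.pow_lt_pow_right one_lt_two n.lt_succ_self)
    apply hmem
    rw [huniq _ _ hi (fun h1 => hmem (h1 ▸ one_mem _)) hz2 hz1]
    exact pow_mem (mem_zpowers a) _
  refine (odd_or_congruences_of_forall_not_dvd hr2 hs2 hnot).imp (fun hodd => ?_) ?_
  · obtain ⟨c, d, hcd⟩ : IsCoprime ((2 : ℤ) ^ (n + 1)) s :=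
      (Int.isCoprime_two_left.mpr hodd).pow_left
    refine ⟨d, ?_⟩
    simp only
    rw [← hs, ← zpow_mul, mul_comm s, ← mul_inv_eq_one]
    nth_rw 2 [← zpow_one a]
    rw [← zpow_sub, ← hdvd]
    exact ⟨-c, by linear_combination hcd⟩
  · rintro ⟨hn, h1, h2⟩
    rw [hdvd, zpow_add, zpow_one] at h1
    rw [hdvd, zpow_sub, mul_inv_eq_one] at h2
    refine ⟨hn, by rw [← hr]; exact eq_inv_of_mul_eq_one_left h1, ?_⟩
    rw [← hs, h2]
    exact_mod_cast zpow_natCast a (2 ^ n)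

/-- An element outside a subgroup of a `p`-group has a power outside the subgroup whose `p`-th
power lies inside. -/
theorem IsPGroup.exists_pow_notMem_pow_succ_mem {p : ℕ} (hG : IsPGroup p G) (H : Subgroup G)
    {g : G} (hg : g ∉ H) : ∃ j : ℕ, g ^ p ^ j ∉ H ∧ g ^ p ^ (j + 1) ∈ H := by
  classical
  have hex : ∃ k, g ^ p ^ k ∈ H := by
    obtain ⟨k, hk⟩ := hG g
    exact ⟨k, hk.symm ▸ one_mem H⟩
  have hpos : Nat.find hex ≠ 0 := fun h0 => hg (by simpa [h0] using Nat.find_spec hex)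
  obtain ⟨j, hj⟩ := Nat.exists_eq_succ_of_ne_zero hpos
  have hspec := Nat.find_spec hex
  rw [hj] at hspec
  exact ⟨j, Nat.find_min hex (by omega), hspec⟩

/-- A nontrivial normal subgroup of a finite `p`-group contains a nontrivial central element. -/
theorem IsPGroup.exists_mem_center_of_normal {p : ℕ} [Fact p.Prime] [Finite G]
    (hG : IsPGroup p G) (N : Subgroup G) [N.Normal] (hN : N ≠ ⊥) :
    ∃ z ∈ N, z ∈ center G ∧ z ≠ 1 := by
  have hNn : Nontrivial N := (nontrivial_iff_ne_bot N).mpr hN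
  have hdvd : p ∣ Nat.card N := by
    obtain ⟨k, hk0, hk⟩ := (hG.to_subgroup N).nontrivial_iff_card.mp hNn
    exact hk ▸ dvd_pow_self _ hk0.ne'
  obtain ⟨z, hz, hz1⟩ :=
    (hG.of_equiv ConjAct.toConjAct).exists_fixed_point_of_prime_dvd_card_of_fixed_point N hdvd
      (a := 1) (fun g => smul_one g)
  refine ⟨z, z.2, mem_center_iff.mpr fun g => ?_, fun h => hz1 (Subtype.ext h.symm)⟩
  have := congrArg Subtype.val (hz (ConjAct.toConjAct g))
  rw [ConjAct.Subgroup.val_conj_smul, ConjAct.toConjAct_smul] at this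
  exact mul_inv_eq_iff_eq_mul.mp this

/-- For normal subgroups `A < C` of a finite `p`-group, some element of `C` outside `A` is central
modulo `A` and has its `p`-th power in `A`. -/
theorem IsPGroup.exists_central_mod_of_not_le {p : ℕ} [Fact p.Prime] [Finite G]
    (hG : IsPGroup p G) (A C : Subgroup G) [A.Normal] [C.Normal] (hAC : ¬ C ≤ A) :
    ∃ x ∈ C, x ∉ A ∧ x ^ p ∈ A ∧ ∀ g : G, x⁻¹ * (g * x * g⁻¹) ∈ A := by
  have hN : C.map (QuotientGroup.mk' A) ≠ ⊥ := by
    rwa [Ne, Subgroup.map_eq_bot_iff, QuotientGroup.ker_mk']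
  have : (C.map (QuotientGroup.mk' A)).Normal :=
    Normal.map ‹_› _ (QuotientGroup.mk'_surjective A)
  obtain ⟨_, ⟨c, hc, rfl⟩, hcent, hc1⟩ :=
    (hG.to_quotient A).exists_mem_center_of_normal _ hN
  have hcA : c ∉ A := fun h => hc1 ((QuotientGroup.eq_one_iff c).mpr h)
  obtain ⟨j, hj, hj'⟩ := hG.exists_pow_notMem_pow_succ_mem A hcA
  refine ⟨c ^ p ^ j, pow_mem hc _, hj, by rwa [← pow_mul, ← pow_succ], fun g => ?_⟩
  have hpow := mem_center_iff.mp (pow_mem hcent (p ^ j)) (g : G ⧸ A)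
  rw [← QuotientGroup.eq_one_iff]
  simp only [QuotientGroup.mk'_apply] at hpow
  simp only [QuotientGroup.mk_mul, QuotientGroup.mk_inv, QuotientGroup.mk_pow]
  rw [hpow]
  group

/-- A finite `2`-group with at most one involution has a normal cyclic subgroup containing its
own centralizer. -/
theorem IsPGroup.exists_normal_zpowers_centralizer_le [Finite G] (hG : IsPGroup 2 G)
    (huniq : ∀ x y : G, x ^ 2 = 1 → x ≠ 1 → y ^ 2 = 1 → y ≠ 1 → x = y) :
    ∃ a : G, (zpowers a).Normal ∧ centralizer (zpowers a : Set G) ≤ zpowers a := by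
  obtain ⟨a, hnorm, hmax⟩ := Set.exists_max_image {a : G | (zpowers a).Normal} orderOf
    (Set.toFinite _) ⟨1, by simp only [zpowers_one_eq_bot, Set.mem_ofPred_eq]; infer_instance⟩
  have : (zpowers a).Normal := hnorm
  refine ⟨a, hnorm, ?_⟩
  by_contra hle
  obtain ⟨x, hxC, hxA, hx2, hx⟩ := hG.exists_central_mod_of_not_le _ _ hle
  have hcomm : a * x = x * a := mem_centralizer_iff.mp hxC a (mem_zpowers a)
  have hconj : x * a * x⁻¹ = a := by rw [← hcomm, mul_inv_cancel_right]
  have haxsq : a ∈ zpowers (x ^ 2) := by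
    obtain ⟨k, hk⟩ := IsPGroup.iff_orderOf.mp hG a
    rcases k with _ | n
    · rw [pow_zero, orderOf_eq_one_iff] at hk
      exact hk ▸ one_mem _
    · rcases mem_zpowers_sq_or_quaternion_relations huniq hk hxA hx2
        (hconj.symm ▸ mem_zpowers a : x * a * x⁻¹ ∈ zpowers a) with h | ⟨hn, hinv, -⟩
      · exact h
      · have ha2 : a ^ 2 = 1 := by
          rw [sq, ← eq_inv_iff_mul_eq_one, ← hinv, hconj]
        have := Nat.le_of_dvd two_pos (hk ▸ orderOf_dvd_of_pow_eq_one ha2)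
        have := Nat.pow_le_pow_right two_pos (show 2 ≤ n + 1 by omega)
        omega
  have hle' : zpowers a ≤ zpowers x := by
    rw [zpowers_le]
    exact zpowers_le.mpr (pow_mem (mem_zpowers x) 2) haxsq
  have hxnorm : (zpowers x).Normal := by
    refine ⟨fun y hy g => ?_⟩
    obtain ⟨i, rfl⟩ := hy
    simp only
    rw [← conj_zpow]
    refine zpow_mem ?_ i
    exact (mul_mem_cancel_left (inv_mem (mem_zpowers x))).mp (hle' (hx g))
  refine hxA (eq_of_le_of_card_ge hle' ?_ ▸ mem_zpowers x)
  simpa only [Nat.card_zpowers] using hmax x hxnorm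

/-- A group generated by a cyclic subgroup `⟨a⟩` of order `2 * n` and an element `b` satisfying
the quaternion relations, with `⟨a⟩` of index two, is a quaternion group. -/
theorem nonempty_mulEquiv_quaternionGroup {a b : G} {n : ℕ} (ha : orderOf a = 2 * n)
    (hb : b ∉ zpowers a) (hconj : b * a * b⁻¹ = a⁻¹) (hb2 : b ^ 2 = a ^ n)
    (hcover : ∀ y : G, y ∉ zpowers a → b⁻¹ * y ∈ zpowers a) :
    Nonempty (G ≃* QuaternionGroup n) := by
  obtain ⟨φ, hφ⟩ : ∃ φ : ZMod (2 * n) →+ Additive G,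
      ∀ i : ℤ, φ (i : ZMod (2 * n)) = Additive.ofMul (a ^ i) :=
    ⟨ZMod.lift (2 * n) ⟨zmultiplesHom (Additive G) (Additive.ofMul a), by
      rw [zmultiplesHom_apply, ← ofMul_zpow, zpow_natCast, ← ha, pow_orderOf_eq_one]; rfl⟩,
      fun i => by rw [ZMod.lift_coe]; rfl⟩
  let ψ : ZMod (2 * n) → G := fun i => (φ i).toMul
  have hψ : ∀ i : ℤ, ψ i = a ^ i := fun i => congrArg Additive.toMul (hφ i)
  have hadd : ∀ i j, ψ (i + j) = ψ i * ψ j := fun i j => congrArg Additive.toMul (map_add φ i j)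
  have hneg : ∀ i, ψ (-i) = (ψ i)⁻¹ := fun i => congrArg Additive.toMul (map_neg φ i)
  have hmem : ∀ i, ψ i ∈ zpowers a := fun i => by
    obtain ⟨k, rfl⟩ := ZMod.intCast_surjective i
    exact ⟨k, (hψ k).symm⟩
  have hinj : Function.Injective ψ := by
    intro i j hij
    obtain ⟨k, rfl⟩ := ZMod.intCast_surjective i
    obtain ⟨l, rfl⟩ := ZMod.intCast_surjective j
    rw [hψ, hψ, zpow_eq_zpow_iff_modEq, ha] at hij
    exact (ZMod.intCast_eq_intCast_iff k l (2 * n)).mpr hij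
  have hswap : ∀ i, ψ i * b = b * ψ (-i) := fun i => by
    obtain ⟨k, rfl⟩ := ZMod.intCast_surjective i
    have h : b * a ^ (-k) * b⁻¹ = a ^ k := by
      rw [← conj_zpow, hconj, inv_zpow', neg_neg]
    rw [hneg, hψ, ← zpow_neg, ← h, inv_mul_cancel_right]
  have hbb : b * b = ψ n := by
    rw [← sq, hb2, ← zpow_natCast, ← hψ, Int.cast_natCast]
  let f : QuaternionGroup n →* G := MonoidHom.mk'
    (fun | .a i => ψ i | .xa i => b * ψ i) (by
      rintro (i | i) (j | j)
      · exact hadd i j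
      · simp only [QuaternionGroup.a_mul_xa]
        rw [← mul_assoc, hswap, mul_assoc, ← hadd, neg_add_eq_sub]
      · simp only [QuaternionGroup.xa_mul_a]
        rw [hadd, mul_assoc]
      · simp only [QuaternionGroup.xa_mul_xa]
        rw [mul_assoc, ← mul_assoc (ψ i), hswap, mul_assoc b, ← mul_assoc b, hbb, ← hadd, ← hadd,
          neg_add_eq_sub, add_sub_assoc])
  refine ⟨(MulEquiv.ofBijective f ⟨?_, fun y => ?_⟩).symm⟩
  · rintro (i | i) (j | j) hij
    · exact congrArg _ (hinj hij)
    · change ψ i = b * ψ j at hij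
      exact absurd ((mul_mem_cancel_right (hmem j)).mp (hij ▸ hmem i)) hb
    · change b * ψ i = ψ j at hij
      exact absurd ((mul_mem_cancel_right (hmem i)).mp (hij ▸ hmem j)) hb
    · exact congrArg _ (hinj (mul_left_cancel hij))
  · by_cases hy : y ∈ zpowers a
    · obtain ⟨k, rfl⟩ := hy
      exact ⟨.a k, hψ k⟩
    · obtain ⟨k, hk⟩ := hcover y hy
      refine ⟨.xa k, ?_⟩
      change b * ψ k = y
      rw [hψ, ← mul_inv_cancel_left b y, ← hk]

/-- A finite noncyclic `2`-group with at most one involution is generalized quaternion. -/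
theorem IsPGroup.exists_mulEquiv_quaternionGroup [Finite G] (hG : IsPGroup 2 G)
    (huniq : ∀ x y : G, x ^ 2 = 1 → x ≠ 1 → y ^ 2 = 1 → y ≠ 1 → x = y) (hcyc : ¬ IsCyclic G) :
    ∃ n : ℕ, 1 ≤ n ∧ Nonempty (G ≃* QuaternionGroup (2 ^ n)) := by
  obtain ⟨a, hnorm, hcent⟩ := hG.exists_normal_zpowers_centralizer_le huniq
  have mem_of_conj : ∀ y : G, y * a * y⁻¹ = a → y ∈ zpowers a := fun y hy =>
    hcent <| mem_centralizer_iff.mpr <| by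
      rintro _ ⟨i, rfl⟩
      exact (Commute.zpow_left (mul_inv_eq_iff_eq_mul.mp hy).symm i)
  obtain ⟨b, hb⟩ : ∃ b, b ∉ zpowers a := by
    by_contra! h
    exact hcyc ⟨a, h⟩
  obtain ⟨n, ha⟩ : ∃ n, orderOf a = 2 ^ (n + 1) := by
    obtain ⟨_ | n, hk⟩ := IsPGroup.iff_orderOf.mp hG a
    · rw [pow_zero, orderOf_eq_one_iff] at hk
      exact absurd (mem_of_conj b (by simp [hk])) hb
    · exact ⟨n, hk⟩
  have of_sq_mem : ∀ y, y ∉ zpowers a → y ^ 2 ∈ zpowers a →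
      1 ≤ n ∧ y * a * y⁻¹ = a⁻¹ ∧ y ^ 2 = a ^ 2 ^ n := fun y hy hy2 =>
    (mem_zpowers_sq_or_quaternion_relations huniq ha hy hy2
      (hnorm.conj_mem a (mem_zpowers a) y)).resolve_left <| by
        rintro ⟨i, hi⟩
        refine hy (mem_of_conj y ?_)
        simp only at hi
        rw [← hi]
        group
  have sq_mem : ∀ y, y ∉ zpowers a → y ^ 2 ∈ zpowers a := by
    intro y hy
    obtain ⟨_ | j, hj, hj'⟩ := hG.exists_pow_notMem_pow_succ_mem _ hy
    · simpa using hj'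
    · obtain ⟨hn, hinv, -⟩ := of_sq_mem _ hj (by rwa [← pow_mul, ← pow_succ])
      obtain ⟨r, hr⟩ := hnorm.conj_mem a (mem_zpowers a) (y ^ 2 ^ j)
      simp only at hr
      have hrr : a ^ (r * r + 1) = 1 := by
        rw [zpow_add, zpow_one, zpow_mul, ← eq_inv_iff_mul_eq_one, ← hinv, hr, conj_zpow, hr]
        group
      have h4 : (4 : ℤ) ∣ r * r + 1 := by
        refine dvd_trans ?_ (orderOf_dvd_iff_zpow_eq_one.mpr hrr)
        rw [ha]
        exact_mod_cast pow_dvd_pow 2 (show 2 ≤ n + 1 by omega)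
      exfalso
      rcases Int.even_or_odd' r with ⟨k, rfl | rfl⟩ <;> ring_nf at h4 <;> omega
  obtain ⟨hn, hconj, hb2⟩ := of_sq_mem b hb (sq_mem b hb)
  refine ⟨n, hn, nonempty_mulEquiv_quaternionGroup (by rw [ha, pow_succ']) hb hconj hb2 ?_⟩
  intro y hy
  apply mem_of_conj
  have hy' := (of_sq_mem y hy (sq_mem y hy)).2.1
  calc b⁻¹ * y * a * (b⁻¹ * y)⁻¹ = b⁻¹ * (y * a * y⁻¹) * b := by group
    _ = a := by rw [hy', ← hconj]; group

end UniqueInvolution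

theorem fixedPointFree_two_group_cyclic_or_quaternion (Q : Type*) [Group Q] [Finite Q]
    (hQ : IsPGroup 2 Q) (K : Type*) [Group K] [Finite K] (hK : Nontrivial K)
    [MulDistribMulAction Q K]
    (hfree : ∀ q : Q, q ≠ 1 → ∀ k : K, q • k = k → k = 1)
    (hncyc : ¬ IsCyclic Q) (h4 : 4 ≤ Nat.card Q) :
    ∃ n : ℕ, 1 ≤ n ∧ Nonempty (Q ≃* QuaternionGroup (2 ^ n)) :=
  hQ.exists_mulEquiv_quaternionGroup
    (fun _ _ hx hx1 hy hy1 => eq_of_sq_eq_one_of_fixedPointFree hfree hx hx1 hy hy1) hncyc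
end
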